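/- arXiv:1403.4385 — 3 statements merged into one kernel-verified Lean document; each statement's English description precedes it below -/
import Mathlib

section
/- Let A and B be unital complex C*-algebras with B nonzero, and suppose the center of B equals ℂ·1 (every central element of B is a scalar multiple of the identity). Then every group isomorphism φ : GL(A) → GL(B) satisfies φ(−1) = −1. -/
noncomputable section

variable {A B : Type*}
  [NormedRing A] [StarRing A] [CStarRing A] [CompleteSpace A]
  [NormedAlgebra ℂ A] [StarModule ℂ A]
  [NormedRing B] [StarRing B] [CStarRing B] [CompleteSpace B]
  [NormedAlgebra ℂ B] [StarModule ℂ B]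

/-- In a complex Banach algebra, an element commuting with every unit is central. -/
theorem commute_of_forall_units_commute {R : Type*} [NormedRing R] [CompleteSpace R]
    [NormedAlgebra ℂ R] {z : R} (hz : ∀ u : Rˣ, Commute z u) (b : R) : Commute z b := by
  obtain ⟨k, hk⟩ : ∃ k : ℂ, ‖b‖ * ‖(1 : R)‖ < ‖k‖ :=
    NormedField.exists_lt_norm ℂ _
  obtain ⟨u, hu⟩ : IsUnit (algebraMap ℂ R k - b) := spectrum.mem_resolventSet_of_norm_lt_mul hk
  have h : b = algebraMap ℂ R k - u := by rw [hu, sub_sub_cancel]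
  rw [h]
  exact (Algebra.commute_algebraMap_right k z).sub_right (hz u)

theorem statement2 [Nontrivial B]
    (hZ : ∀ z : B, (∀ b : B, z * b = b * z) → ∃ c : ℂ, z = c • (1 : B))
    (φ : Aˣ ≃* Bˣ) :
    φ (-1) = -1 := by
  have hcomm (u : Bˣ) : Commute (φ (-1) : B) u := by
    obtain ⟨a, rfl⟩ := φ.surjective u
    have h : φ (-1) * φ a = φ a * φ (-1) := by
      simp only [← map_mul, neg_mul, mul_neg, one_mul, mul_one]
    exact congrArg Units.val h
  obtain ⟨c, hc⟩ := hZ _ (commute_of_forall_units_commute hcomm)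
  have hsq : (φ (-1) : B) * φ (-1) = 1 := by
    rw [← Units.val_mul, ← map_mul]
    simp
  have hc2 : c * c = 1 := by
    apply (algebraMap ℂ B).injective
    rw [map_mul, map_one, Algebra.algebraMap_eq_smul_one, ← hc, hsq]
  rcases mul_self_eq_one_iff.mp hc2 with rfl | rfl
  · have h1 : φ (-1) = 1 := Units.ext (by simpa using hc)
    have hA : (-1 : A) = 1 := by
      simpa using congrArg Units.val (φ.map_eq_one_iff.mp h1)
    have h2 : (2 : ℂ) • (1 : A) = 0 := by
      rw [two_smul]
      nth_rewrite 1 [← hA]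
      exact neg_add_cancel 1
    have h0 : (1 : A) = 0 := (smul_eq_zero.mp h2).resolve_left two_ne_zero
    have : Subsingleton A := subsingleton_of_zero_eq_one h0.symm
    have : Subsingleton Bˣ := φ.symm.injective.subsingleton
    exact Subsingleton.elim _ _
  · exact Units.ext (by simpa using hc)

end
end

section
/- Let A and B be unital complex C*-algebras with B nonzero, whose center satisfies Z(B) = ℂ·1. Let φ : GL(A) → GL(B) be a group isomorphism and θ the induced map on idempotents. Then θ(1) = 1, and θ(1 − e) = 1 − θ(e) for every idempotent e of A. -/
noncomputable section

/-- The symmetry `1 - 2e` associated to an idempotent `e` is a unit (its own inverse). -/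
def symUnit {A : Type*} [Ring A] {e : A} (he : IsIdempotentElem e) : Aˣ where
  val := 1 - 2 * e
  inv := 1 - 2 * e
  val_inv := by
    have h : e * e = e := he
    have expand : (1 - 2 * e) * (1 - 2 * e) = 1 - 4 * e + 4 * (e * e) := by noncomm_ring
    rw [expand, h]; noncomm_ring
  inv_val := by
    have h : e * e = e := he
    have expand : (1 - 2 * e) * (1 - 2 * e) = 1 - 4 * e + 4 * (e * e) := by noncomm_ring
    rw [expand, h]; noncomm_ring

/-- The map `θ_φ` induced on idempotents by a map `φ` between the groups of invertible
elements, determined by `1 - 2 θ_φ(e) = φ(1 - 2e)`, i.e. `θ_φ(e) = (1 - φ(1 - 2e))/2`;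
it is extended by `0` off the set of idempotents. -/
noncomputable def theta {A B : Type*} [Ring A] [Ring B] [Algebra ℂ B]
    (φ : Aˣ → Bˣ) (e : A) : B :=
  letI := Classical.propDecidable (IsIdempotentElem e)
  if h : IsIdempotentElem e then (2 : ℂ)⁻¹ • ((1 : B) - (φ (symUnit h) : B)) else 0

variable {A B : Type*}
  [NormedRing A] [StarRing A] [CStarRing A] [CompleteSpace A]
  [NormedAlgebra ℂ A] [StarModule ℂ A]
  [NormedRing B] [StarRing B] [CStarRing B] [CompleteSpace B]
  [NormedAlgebra ℂ B] [StarModule ℂ B]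


/-- An element of a complex Banach algebra commuting with all units is central. -/
theorem mul_comm_of_forall_units {R : Type*} [NormedRing R] [CompleteSpace R]
    [NormedAlgebra ℂ R] {z : R} (hz : ∀ u : Rˣ, z * u = u * z) (b : R) : z * b = b * z := by
  obtain ⟨k, hk⟩ := NormedField.exists_lt_norm ℂ (‖b‖ * ‖(1 : R)‖)
  obtain ⟨u, hu⟩ := spectrum.mem_resolventSet_iff.mp
    (spectrum.mem_resolventSet_of_norm_lt_mul hk)
  have h := hz u
  rw [hu, mul_sub, sub_mul, Algebra.commutes k z] at h
  exact sub_right_injective h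

/-- A group isomorphism between the unit groups of complex Banach algebras sends `-1` to `-1`
if the target has only scalars in its center. -/
theorem map_neg_one_of_center_eq_scalars {R S : Type*} [Ring R] [Algebra ℂ R]
    [NormedRing S] [CompleteSpace S] [NormedAlgebra ℂ S] [Nontrivial S]
    (hZ : ∀ z : S, (∀ b : S, z * b = b * z) → ∃ c : ℂ, z = c • (1 : S))
    (φ : Rˣ ≃* Sˣ) : φ (-1) = -1 := by
  have hS : (1 : Sˣ) ≠ -1 := by
    intro h
    have h1 : (1 : S) = -1 := by simpa using congrArg Units.val h
    have h2 : (2 : ℂ) • (1 : S) = 0 := by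
      rw [two_smul]
      nth_rewrite 1 [h1]
      exact neg_add_cancel 1
    simp at h2
  have : Nontrivial Sˣ := ⟨1, -1, hS⟩
  have : Nontrivial Rˣ := φ.toEquiv.nontrivial
  have : Nontrivial R := Units.val_injective.nontrivial
  have hR : (-1 : Rˣ) ≠ 1 := by
    intro h
    have h1 : (-1 : R) = 1 := by simpa using congrArg Units.val h
    have h2 : (2 : ℂ) • (1 : R) = 0 := by
      rw [two_smul]
      nth_rewrite 1 [← h1]
      exact neg_add_cancel 1
    simp at h2
  have hcomm (u : Sˣ) : (φ (-1) : S) * u = u * φ (-1) := by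
    rw [← Units.val_mul, ← Units.val_mul, ← φ.apply_symm_apply u, ← map_mul, ← map_mul,
      neg_one_mul, mul_neg_one]
  obtain ⟨c, hc⟩ := hZ _ (mul_comm_of_forall_units hcomm)
  have hsq : (φ (-1) : S) * φ (-1) = 1 := by
    rw [← Units.val_mul, ← map_mul]
    simp
  have hcc : c * c = 1 := by
    rw [hc, smul_mul_smul_comm, mul_one] at hsq
    exact smul_left_injective ℂ (one_ne_zero (α := S)) (by simpa using hsq)
  rcases mul_self_eq_one_iff.mp hcc with rfl | rfl
  · refine absurd (φ.injective ?_) hR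
    rw [map_one]
    exact Units.ext (by simpa using hc)
  · exact Units.ext (by simpa using hc)

theorem symUnit_one {R : Type*} [Ring R] :
    symUnit (IsIdempotentElem.one : IsIdempotentElem (1 : R)) = -1 :=
  Units.ext <| by
    change (1 : R) - 2 * 1 = -1
    noncomm_ring

theorem symUnit_one_sub {R : Type*} [Ring R] {e : R} (he : IsIdempotentElem e) :
    symUnit he.one_sub = -1 * symUnit he :=
  Units.ext <| by
    change (1 : R) - 2 * (1 - e) = -1 * (1 - 2 * e)
    noncomm_ring

theorem theta_of_isIdempotentElem {R S : Type*} [Ring R] [Ring S] [Algebra ℂ S]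
    (φ : Rˣ → Sˣ) {e : R} (he : IsIdempotentElem e) :
    theta φ e = (2 : ℂ)⁻¹ • ((1 : S) - (φ (symUnit he) : S)) :=
  dif_pos he

theorem statement3 [Nontrivial B]
    (hZ : ∀ z : B, (∀ b : B, z * b = b * z) → ∃ c : ℂ, z = c • (1 : B))
    (φ : Aˣ ≃* Bˣ) :
    theta (⇑φ) (1 : A) = 1 ∧
    ∀ e : A, IsIdempotentElem e → theta (⇑φ) (1 - e) = 1 - theta (⇑φ) e := by
  have hneg := map_neg_one_of_center_eq_scalars hZ φ
  constructor
  · rw [theta_of_isIdempotentElem _ IsIdempotentElem.one, symUnit_one, hneg, Units.val_neg,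
      Units.val_one]
    module
  · intro e he
    rw [theta_of_isIdempotentElem _ he.one_sub, theta_of_isIdempotentElem _ he,
      symUnit_one_sub he, map_mul, hneg, Units.val_mul, Units.val_neg, Units.val_one, neg_one_mul]
    module

end
end

section
/- Let A and B be simple unital complex C*-algebras, φ : GL(A) → GL(B) a group isomorphism, and θ the induced map on idempotents. Then for every idempotent e of A and every nonzero λ ∈ ℂ, the element λe + 1 − e is invertible in A (with inverse λ⁻¹e + 1 − e) and there exist complex numbers α, β such that φ(λe + 1 − e) = α θ(e) + β θ(1 − e). -/
noncomputable section

variable {A B : Type*}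
  [NormedRing A] [StarRing A] [CStarRing A] [CompleteSpace A]
  [NormedAlgebra ℂ A] [StarModule ℂ A]
  [NormedRing B] [StarRing B] [CStarRing B] [CompleteSpace B]
  [NormedAlgebra ℂ B] [StarModule ℂ B]

/-- In a simple ring, an element of the bicommutant of an idempotent `f` that does not vanish
on `f` is invertible on the corner of `f`. -/
theorem exists_mul_eq_of_mem_bicommutant {R : Type*} [Ring R] [IsSimpleRing R] {f w : R}
    (hf : IsIdempotentElem f) (hw : ∀ x, Commute f x → Commute w x) (h0 : w * f ≠ 0) :
    ∃ c, Commute f c ∧ w * c = f ∧ c * w = f := by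
  have hcorner (x : R) : Commute f (f * x * f) := by
    have h : f * f = f := hf
    simp only [Commute, SemiconjBy, mul_assoc, h]
    simp only [← mul_assoc, h]
  let I : TwoSidedIdeal R := TwoSidedIdeal.mk'
    {x | ∀ r s, ∃ c, f * (r * x * s) * f = w * (f * c * f)}
    (fun r s => ⟨0, by simp⟩)
    (fun {x y} hx hy r s => by
      obtain ⟨c, hc⟩ := hx r s
      obtain ⟨d, hd⟩ := hy r s
      exact ⟨c + d, by simp only [mul_add, add_mul, hc, hd]⟩)
    (fun {x} hx r s => by
      obtain ⟨c, hc⟩ := hx r s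
      exact ⟨-c, by simp only [mul_neg, neg_mul, hc]⟩)
    (fun {x y} hy r s => by
      obtain ⟨c, hc⟩ := hy (r * x) s
      exact ⟨c, by rw [← hc]; simp only [mul_assoc]⟩)
    (fun {x y} hx r s => by
      obtain ⟨c, hc⟩ := hx r (y * s)
      exact ⟨c, by rw [← hc]; simp only [mul_assoc]⟩)
  have hmem : w * f ∈ I := by
    refine (TwoSidedIdeal.mem_mk' ..).2 fun r s => ⟨r * f * s, ?_⟩
    have hwf : w * f = f * w * f := by
      rw [← (hw f (Commute.refl f)).eq, mul_assoc, hf.eq]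
    calc f * (r * (w * f) * s) * f = (f * r * f) * w * (f * s * f) := by
          rw [hwf]; simp only [mul_assoc]
      _ = w * (f * r * f) * (f * s * f) := by rw [(hw _ (hcorner r)).eq]
      _ = w * (f * r * (f * f) * s * f) := by simp only [mul_assoc]
      _ = w * (f * (r * f * s) * f) := by rw [hf.eq]; simp only [mul_assoc]
  have h1 : (1 : R) ∈ I := IsSimpleRing.one_mem_of_ne_zero_mem I h0 hmem
  obtain ⟨c, hc⟩ := (TwoSidedIdeal.mem_mk' ..).1 h1 1 1
  have hc' : w * (f * c * f) = f := by rw [← hc]; simp [hf.eq]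
  exact ⟨f * c * f, hcorner c, hc', (hw _ (hcorner c)).eq ▸ hc'⟩

/-- In a simple complex Banach algebra, the bicommutant of an idempotent `f` acts on `f` by
scalars. -/
theorem exists_mul_eq_smul_of_mem_bicommutant {R : Type*} [NormedRing R] [NormedAlgebra ℂ R]
    [CompleteSpace R] [IsSimpleRing R] {f w : R}
    (hf : IsIdempotentElem f) (hw : ∀ x, Commute f x → Commute w x) :
    ∃ α : ℂ, w * f = α • f := by
  by_cases hf0 : f = 0
  · exact ⟨0, by simp [hf0]⟩
  let E : Submodule ℂ R := (ContinuousLinearMap.mul ℂ R (1 - f)).ker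
  have hE (x : R) : x ∈ E ↔ f * x = x := by
    simp [E, sub_eq_zero, eq_comm]
  have : CompleteSpace E :=
    (ContinuousLinearMap.isClosed_ker (ContinuousLinearMap.mul ℂ R (1 - f))).completeSpace_coe
  have : Nontrivial E := ⟨⟨f, (hE f).2 hf⟩, 0, fun h => hf0 (congrArg Subtype.val h)⟩
  let T (a : R) (ha : Commute f a) : E →L[ℂ] E :=
    ((ContinuousLinearMap.mul ℂ R a).comp E.subtypeL).codRestrict E fun x => by
      have hx := (hE x).1 x.2
      rw [hE]
      simp only [ContinuousLinearMap.comp_apply, Submodule.subtypeL_apply,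
        ContinuousLinearMap.mul_apply']
      rw [← mul_assoc, ha.eq, mul_assoc, hx]
  have hT (a : R) (ha : Commute f a) (x : E) : (T a ha x : R) = a * x := rfl
  have hwf : Commute f w := (hw f (Commute.refl f)).symm
  obtain ⟨μ, hμ⟩ := spectrum.nonempty (T w hwf)
  refine ⟨μ, ?_⟩
  by_contra hne
  have hw' (x : R) (hx : Commute f x) : Commute (algebraMap ℂ R μ - w) x :=
    Commute.sub_left (Algebra.commutes μ x) (hw x hx)
  obtain ⟨c, hfc, hc1, hc2⟩ := exists_mul_eq_of_mem_bicommutant hf hw' (by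
    rw [sub_mul, ← Algebra.smul_def]
    exact fun h => hne (sub_eq_zero.1 h).symm)
  refine hμ (isUnit_iff_exists.2 ⟨T c hfc, ?_, ?_⟩)
  · ext x
    have : (algebraMap ℂ R μ - w) * (c * (x : R)) = x := by
      rw [← mul_assoc, hc1, (hE x).1 x.2]
    simpa [hT, sub_mul, Algebra.algebraMap_eq_smul_one] using this
  · ext x
    have : c * ((algebraMap ℂ R μ - w) * (x : R)) = x := by
      rw [← mul_assoc, hc2, (hE x).1 x.2]
    simpa [hT, sub_mul, mul_sub, Algebra.algebraMap_eq_smul_one] using this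

/-- An element of a complex Banach algebra lies in the bicommutant of `f` as soon as it commutes
with the units commuting with `f`. -/
theorem commute_of_forall_units {R : Type*} [NormedRing R] [NormedAlgebra ℂ R]
    [CompleteSpace R] {f w : R}
    (hw : ∀ u : Rˣ, Commute f u → Commute w u) (x : R) (hx : Commute f x) : Commute w x := by
  obtain ⟨r, hr⟩ := NormedField.exists_lt_norm ℂ (‖x‖ * ‖(1 : R)‖)
  have hcomm (y : R) : Commute y (algebraMap ℂ R r) := (Algebra.commutes r y).symm
  have hu : IsUnit (algebraMap ℂ R r - x) := spectrum.mem_resolventSet_of_norm_lt_mul hr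
  have h := hw hu.unit ((hcomm f).sub_right hx)
  simpa using (hcomm w).sub_right h

/-- In a complex algebra, an element commutes with `1 - 2e` iff it commutes with `e`. -/
theorem commute_one_sub_two_mul_iff {R : Type*} [Ring R] [Algebra ℂ R] {e x : R} :
    Commute (1 - 2 * e) x ↔ Commute e x := by
  refine ⟨fun h => ?_, fun h => (Commute.one_left x).sub_left
    ((Commute.ofNat_left 2 x).mul_left h)⟩
  have he : e = (2 : ℂ)⁻¹ • (1 - (1 - 2 * e)) := by
    rw [sub_sub_cancel, two_mul, ← two_smul ℂ e, smul_smul]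
    norm_num
  rw [he]
  exact ((Commute.one_left x).sub_left h).smul_left _

/-- An isomorphism between the unit groups of simple complex Banach algebras preserves `-1`. -/
theorem map_neg_one_of_mulEquiv_units {R S : Type*} [Ring R] [Algebra ℂ R] [Nontrivial R]
    [NormedRing S] [NormedAlgebra ℂ S] [CompleteSpace S] [IsSimpleRing S] (φ : Rˣ ≃* Sˣ) :
    φ (-1) = -1 := by
  obtain ⟨α, hα⟩ := exists_mul_eq_smul_of_mem_bicommutant (IsIdempotentElem.one (M := S))
    (commute_of_forall_units (w := (φ (-1) : S)) fun u _ => by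
      have h : Commute (-1) (φ.symm u) := Commute.neg_one_left _
      have h' := h.map φ
      rw [φ.apply_symm_apply] at h'
      exact h'.units_val)
  rw [mul_one] at hα
  have hsq : φ (-1) * φ (-1) = 1 := by rw [← map_mul]; simp
  have hα2 : α * α = 1 := by
    have h := congrArg Units.val hsq
    rw [Units.val_mul, hα, smul_mul_smul_comm, mul_one, Units.val_one,
      ← Algebra.algebraMap_eq_smul_one, ← map_one (algebraMap ℂ S)] at h
    exact (algebraMap ℂ S).injective h
  rcases mul_self_eq_one_iff.1 hα2 with rfl | rfl
  · have h1 : φ (-1) = 1 := Units.ext (by simpa using hα)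
    have h2 : (-1 : Rˣ) = 1 := φ.injective (by rw [h1, map_one])
    have : CharZero R := charZero_of_injective_algebraMap (algebraMap ℂ R).injective
    have h3 : (-1 : R) = 1 := by simpa using congrArg Units.val h2
    norm_num at h3
  · exact Units.ext (by simpa using hα)

section Theta

variable {R S : Type*} [Ring R] [Ring S] [Algebra ℂ S]

theorem theta_eq (φ : Rˣ → Sˣ) {e : R} (he : IsIdempotentElem e) :
    theta φ e = (2 : ℂ)⁻¹ • (1 - (φ (symUnit he) : S)) := by
  rw [theta, dif_pos he]

theorem one_sub_two_mul_theta (φ : Rˣ → Sˣ) {e : R} (he : IsIdempotentElem e) :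
    1 - 2 * theta φ e = φ (symUnit he) := by
  rw [theta_eq φ he, two_mul, ← two_smul ℂ, smul_smul]
  norm_num

theorem symUnit_mul_self {e : R} (he : IsIdempotentElem e) : symUnit he * symUnit he = 1 :=
  Units.ext (symUnit he).val_inv

theorem isIdempotentElem_theta (φ : Rˣ ≃* Sˣ) {e : R} (he : IsIdempotentElem e) :
    IsIdempotentElem (theta φ e) := by
  have hsq : (φ (symUnit he) : S) * φ (symUnit he) = 1 := by
    rw [← Units.val_mul, ← map_mul, symUnit_mul_self, map_one, Units.val_one]
  rw [theta_eq _ he, IsIdempotentElem, smul_mul_smul_comm, sub_mul, mul_sub, mul_sub, hsq, one_mul,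
    one_mul, mul_one]
  module

theorem theta_one_sub (φ : Rˣ ≃* Sˣ) (hφ : φ (-1) = -1) {e : R} (he : IsIdempotentElem e) :
    theta φ (1 - e) = 1 - theta φ e := by
  have h : symUnit he.one_sub = -1 * symUnit he := Units.ext (by
    simp only [symUnit, Units.val_mul, Units.val_neg, Units.val_one]
    noncomm_ring)
  rw [theta_eq _ he.one_sub, theta_eq _ he, h, map_mul, hφ, Units.val_mul, Units.val_neg,
    Units.val_one, neg_one_mul]
  module

end Theta

theorem statement4 [IsSimpleRing A] [IsSimpleRing B] (φ : Aˣ ≃* Bˣ)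
    (e : A) (he : IsIdempotentElem e) (lam : ℂ) (hlam : lam ≠ 0) :
    ((lam • e + 1 - e) * (lam⁻¹ • e + 1 - e) = 1 ∧
      (lam⁻¹ • e + 1 - e) * (lam • e + 1 - e) = 1) ∧
    ∀ v : Aˣ, (v : A) = lam • e + 1 - e →
      ∃ α β : ℂ, ((φ v : Bˣ) : B) = α • theta (⇑φ) e + β • theta (⇑φ) (1 - e) := by
  have hmul (a b : ℂ) (hab : a * b = 1) : (a • e + 1 - e) * (b • e + 1 - e) = 1 := by
    have h : (a • e + 1 - e) * (b • e + 1 - e) = (a * b) • e + 1 - e := by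
      simp only [add_mul, sub_mul, mul_add, mul_sub, smul_mul_assoc, mul_smul_comm, one_mul,
        mul_one, he.eq]
      module
    rw [h, hab, one_smul, add_sub_cancel_left]
  refine ⟨⟨hmul _ _ (mul_inv_cancel₀ hlam), hmul _ _ (inv_mul_cancel₀ hlam)⟩, fun v hv => ?_⟩
  have hf := isIdempotentElem_theta φ he
  have hbi : ∀ x, Commute (theta φ e) x → Commute ((φ v : Bˣ) : B) x := by
    refine commute_of_forall_units fun u hu => ?_
    rw [← commute_one_sub_two_mul_iff, one_sub_two_mul_theta _ he, Commute.units_val_iff] at hu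
    have h := hu.map φ.symm
    rw [φ.symm_apply_apply] at h
    have he' : Commute e (φ.symm u : Aˣ) := commute_one_sub_two_mul_iff.1 h.units_val
    have hv' : Commute v (φ.symm u) := Commute.units_val_iff.1 (by
      rw [hv]
      exact ((he'.smul_left lam).add_left (Commute.one_left _)).sub_left he')
    have h' := hv'.map φ
    rw [φ.apply_symm_apply] at h'
    exact h'.units_val
  obtain ⟨α, hα⟩ := exists_mul_eq_smul_of_mem_bicommutant hf hbi
  obtain ⟨β, hβ⟩ := exists_mul_eq_smul_of_mem_bicommutant hf.one_sub fun x hx =>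
    hbi x (by simpa using (Commute.one_left x).sub_left hx)
  refine ⟨α, β, ?_⟩
  rw [theta_one_sub φ (map_neg_one_of_mulEquiv_units φ) he, ← hα, ← hβ, ← mul_add,
    add_sub_cancel, mul_one]

end
end
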